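/- arXiv:0810.5240 — 3 statements merged into one kernel-verified Lean document; each statement's English description precedes it below -/
import Mathlib

section
/- Let k be a field of characteristic zero, let λ, μ ∈ k be nonzero, and let l ≤ m be positive integers. Then the Kronecker product J_λ(l) ⊗ J_μ(m) is similar to the block-diagonal direct sum ⊕_{i=0}^{l−1} J_{λμ}(l + m − 2i − 1). -/
open Matrix Kronecker

/-- The Jordan block of size `l` with eigenvalue `c` : the `l × l` matrix with `c` on the
diagonal, `1` directly above the diagonal and `0` elsewhere. -/
def jordanBlock {k : Type*} [Field k] (c : k) (l : ℕ) : Matrix (Fin l) (Fin l) k :=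
  Matrix.of fun i j => if (j : ℕ) = i then c else if (j : ℕ) = (i : ℕ) + 1 then 1 else 0

/-- Similarity of square matrices, allowing reindexing along a bijection of the
(equinumerous) index types. -/
def MatSimilar {k : Type*} [Field k] {α β : Type*} [Fintype α] [DecidableEq α]
    [Fintype β] [DecidableEq β] (A : Matrix α α k) (B : Matrix β β k) : Prop :=
  ∃ e : α ≃ β, ∃ T : Matrix β β k, IsUnit T ∧ Matrix.reindex e e A = T * B * T⁻¹

section
open Polynomial
theorem key_inj {k : Type*} [Field k] [CharZero k] (l m i : ℕ) (hi : i < l) (hlm : l ≤ m)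
    (f : k[X]) (hf : f.natDegree ≤ i)
    (h : ∀ a, l - 1 - i ≤ a → a ≤ l - 1 → ((1 + X) ^ (l + m - 2 - 2 * i) * f).coeff a = 0) :
    f = 0 := by
  by_contra hf0
  set D := l + m - 2 - 2 * i with hD
  set F := (1 + X) ^ D * f with hF
  set s := l - 1 - i with hs
  have h1X : (1 + X : k[X]) = X + C 1 := by rw [C_1, add_comm]
  have hdegX : (1 + X : k[X]).natDegree = 1 := by rw [h1X]; exact natDegree_X_add_C 1
  have h1X0 : (1 + X : k[X]) ≠ 0 := by intro h; rw [h] at hdegX; simp at hdegX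
  have hFdeg : F.natDegree = D + f.natDegree := by
    rw [hF, natDegree_mul (pow_ne_zero _ h1X0) hf0, natDegree_pow, hdegX, mul_one]
  have hF0 : F ≠ 0 := mul_ne_zero (pow_ne_zero _ h1X0) hf0
  have hG : derivative^[s] F = 0 := by
    by_contra hG
    have d1 : X ^ (i + 1) ∣ derivative^[s] F := by
      rw [X_pow_dvd_iff]
      intro d hd
      rw [coeff_iterate_derivative, h (d + s) (by omega) (by omega), smul_zero]
    have d2 : (1 + X) ^ (D - s) ∣ derivative^[s] F :=
      pow_sub_dvd_iterate_derivative_of_pow_dvd s (Dvd.intro _ rfl)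
    have hc : IsCoprime (X : k[X]) (1 + X) := ⟨-1, 1, by ring⟩
    have d3 := (hc.pow (m := i + 1) (n := D - s)).mul_dvd d1 d2
    have := natDegree_le_of_dvd d3 hG
    rw [natDegree_mul (pow_ne_zero _ X_ne_zero) (pow_ne_zero _ h1X0), natDegree_pow,
      natDegree_pow, hdegX, natDegree_X] at this
    have h2 := natDegree_iterate_derivative F s
    omega
  have : F.coeff F.natDegree = 0 := by
    have h3 := congrArg (fun p => p.coeff (F.natDegree - s)) hG
    simp only [coeff_iterate_derivative, coeff_zero] at h3
    rw [Nat.sub_add_cancel (by omega)] at h3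
    rcases smul_eq_zero.1 h3 with h4 | h4
    · rw [Nat.descFactorial_eq_zero_iff_lt] at h4; omega
    · exact h4
  exact hF0 (leadingCoeff_eq_zero.1 this)

theorem key_ex {k : Type*} [Field k] [CharZero k] (l m i : ℕ) (hi : i < l) (hlm : l ≤ m) :
    ∃ f : k[X], f.natDegree ≤ i ∧ ∀ a, l - 1 - i ≤ a → a ≤ l - 1 →
      ((1 + X) ^ (l + m - 2 - 2 * i) * f).coeff a = (-1) ^ a := by
  let e := degreeLTEquiv k (i + 1)
  let Φ : degreeLT k (i + 1) →ₗ[k] (Fin (i + 1) → k) :=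
    LinearMap.pi fun b => (lcoeff k (l - 1 - i + b)) ∘ₗ
      (LinearMap.mulLeft k ((1 + X : k[X]) ^ (l + m - 2 - 2 * i))) ∘ₗ (degreeLT k (i + 1)).subtype
  have hdeg : ∀ f : degreeLT k (i + 1), (f : k[X]).natDegree ≤ i := by
    intro f
    have := mem_degreeLT.1 f.2
    by_cases h0 : (f : k[X]) = 0
    · simp [h0]
    · exact Nat.lt_succ_iff.1 ((natDegree_lt_iff_degree_lt h0).2 this)
  have hinj : Function.Injective Φ := by
    rw [← LinearMap.ker_eq_bot, LinearMap.ker_eq_bot']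
    intro f hf
    apply Subtype.ext
    refine key_inj l m i hi hlm (f : k[X]) (hdeg f) ?_
    intro a h1 h2
    have := congrFun hf ⟨a - (l - 1 - i), by omega⟩
    simp only [Φ, LinearMap.pi_apply, LinearMap.comp_apply, lcoeff_apply, Submodule.subtype_apply,
      LinearMap.mulLeft_apply, Pi.zero_apply] at this
    rwa [Nat.add_sub_cancel' h1] at this
  have hsurj : Function.Surjective Φ := by
    have : Function.Surjective (Φ ∘ₗ e.symm.toLinearMap) :=
      LinearMap.injective_iff_surjective.1 (hinj.comp e.symm.injective)
    exact fun y => by obtain ⟨x, hx⟩ := this y; exact ⟨_, hx⟩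
  obtain ⟨f, hf⟩ := hsurj (fun b => (-1) ^ (l - 1 - i + b))
  refine ⟨f, hdeg f, fun a h1 h2 => ?_⟩
  have := congrFun hf ⟨a - (l - 1 - i), by omega⟩
  simp only [Φ, LinearMap.pi_apply, LinearMap.comp_apply, lcoeff_apply, Submodule.subtype_apply,
      LinearMap.mulLeft_apply] at this
  rwa [Nat.add_sub_cancel' h1] at this

section
variable {k R : Type*} [Field k] [CommRing R] [Algebra k R]

/-- homogenization evaluated at `x, y` -/
noncomputable def homEv (x y : R) (d : ℕ) (f : k[X]) : R :=
  ∑ a ∈ Finset.range (d + 1), f.coeff a • (x ^ a * y ^ (d - a))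

theorem homEv_step (x y : R) (d : ℕ) (f : k[X]) (hf : f.natDegree ≤ d) :
    (x + y) * homEv x y d f = homEv x y (d + 1) ((1 + X) * f) := by
  have h0 : f.coeff (d + 1) = 0 := coeff_eq_zero_of_natDegree_lt (by omega)
  unfold homEv
  have e : ∀ a, ((1 + X) * f).coeff a = f.coeff a + (X * f).coeff a := by
    intro a; rw [add_mul, one_mul, coeff_add]
  simp only [e, add_smul, Finset.sum_add_distrib]
  rw [Finset.sum_range_succ _ (d + 1), h0, zero_smul, add_zero]
  rw [Finset.sum_range_succ' _ (d + 1)]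
  simp only [coeff_X_mul, coeff_X_mul_zero, zero_smul, add_zero]
  rw [add_mul, add_comm, Finset.mul_sum, Finset.mul_sum]
  congr 1
  · refine Finset.sum_congr rfl fun a ha => ?_
    rw [Finset.mem_range] at ha
    rw [mul_smul_comm, show d + 1 - a = (d - a) + 1 by omega]; congr 1; ring
  · refine Finset.sum_congr rfl fun a ha => ?_
    rw [mul_smul_comm, show d + 1 - (a + 1) = d - a by omega]; congr 1; ring

theorem natDegree_step (D : ℕ) (f : k[X]) (i : ℕ) (hf : f.natDegree ≤ i) :
    ((1 + X) ^ D * f).natDegree ≤ i + D := by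
  have : (1 + X : k[X]).natDegree ≤ 1 := by
    rw [← C_1, add_comm]; exact (natDegree_X_add_C 1).le
  have h2 : ((1 + X : k[X]) ^ D).natDegree ≤ D := by
    simpa using natDegree_pow_le_of_le D this
  have := natDegree_mul_le (p := (1 + X : k[X]) ^ D) (q := f)
  omega

theorem homEv_pow (x y : R) (d : ℕ) (f : k[X]) (hf : f.natDegree ≤ d) (D : ℕ) :
    (x + y) ^ D * homEv x y d f = homEv x y (d + D) ((1 + X) ^ D * f) := by
  induction D with
  | zero => simp
  | succ D ih =>
    rw [pow_succ', mul_assoc, ih, homEv_step _ _ _ _ (natDegree_step D f d hf), pow_succ',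
      mul_assoc, add_assoc]

/-- generators of the chains -/
theorem chain_gen [CharZero k] (x y : R) (l m : ℕ) (hlm : l ≤ m) (hx : x ^ l = 0) (hy : y ^ m = 0)
    (i : ℕ) (hi : i < l) :
    ∃ v : R, (x + y) ^ (l + m - 2 * i - 1) * v = 0 ∧
      x ^ (i + 1) * ((x + y) ^ (l + m - 2 - 2 * i) * v) = 0 ∧
      ∃ c : k, c ≠ 0 ∧ x ^ i * ((x + y) ^ (l + m - 2 - 2 * i) * v) =
        c • (x ^ (l - 1) * y ^ (m - 1)) := by
  obtain ⟨f, hf, hc⟩ := key_ex (k := k) l m i hi hlm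
  have hx' : ∀ a, l ≤ a → x ^ a = 0 := fun a ha => pow_eq_zero_of_le ha hx
  have hy' : ∀ a, m ≤ a → y ^ a = 0 := fun a ha => pow_eq_zero_of_le ha hy
  refine ⟨homEv x y i f, ?_, ?_, (-1) ^ (l - 1 - i), by simp, ?_⟩
  · rw [homEv_pow _ _ _ _ hf, show l + m - 2 * i - 1 = (l + m - 2 - 2 * i) + 1 by omega]
    refine Finset.sum_eq_zero fun a ha => ?_
    rw [Finset.mem_range] at ha
    by_cases h1 : l ≤ a
    · rw [hx' a h1]; simp
    by_cases h2 : m ≤ i + (l + m - 2 - 2 * i + 1) - a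
    · rw [hy' _ h2]; simp
    obtain ⟨b, rfl⟩ : ∃ b, a = b + 1 := ⟨a - 1, by omega⟩
    rw [pow_succ', mul_assoc, add_mul, one_mul, coeff_add, coeff_X_mul,
      hc _ (by omega) (by omega), hc _ (by omega) (by omega), pow_succ]
    simp
  · rw [homEv_pow _ _ _ _ hf, homEv, Finset.mul_sum]
    refine Finset.sum_eq_zero fun a ha => ?_
    rw [mul_smul_comm, ← mul_assoc, ← pow_add]
    by_cases h1 : l ≤ i + 1 + a
    · rw [hx' _ h1]; simp
    · rw [hy' _ (by omega)]; simp
  · rw [homEv_pow _ _ _ _ hf, homEv, Finset.mul_sum, Finset.sum_eq_single (l - 1 - i)]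
    · rw [hc _ (by omega) (by omega), mul_smul_comm, ← mul_assoc, ← pow_add]
      rw [show i + (l - 1 - i) = l - 1 by omega,
        show i + (l + m - 2 - 2 * i) - (l - 1 - i) = m - 1 by omega]
    · intro a ha hne
      rw [mul_smul_comm, ← mul_assoc, ← pow_add]
      by_cases h1 : l ≤ i + a
      · rw [hx' _ h1]; simp
      · rw [hy' _ (by omega)]; simp
    · intro h; exact absurd (Finset.mem_range.2 (by omega)) h

open Classical in
/-- the full chains are linearly independent -/
theorem chains [CharZero k] (x y u : R) (hu : IsUnit u) (l m : ℕ) (hlm : l ≤ m)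
    (hx : x ^ l = 0) (hy : y ^ m = 0) (hxy : x ^ (l - 1) * y ^ (m - 1) ≠ 0) :
    ∃ v : Fin l → R, (∀ i : Fin l, (u * (x + y)) ^ (l + m - 2 * (i : ℕ) - 1) * v i = 0) ∧
      ∀ c : (Σ i : Fin l, Fin (l + m - 2 * (i : ℕ) - 1)) → k,
        ∑ p, c p • ((u * (x + y)) ^ (l + m - 2 - 2 * (p.1 : ℕ) - (p.2 : ℕ)) * v p.1) = 0 →
          c = 0 := by
  choose v hv1 hv2 hv3 using fun i : Fin l => chain_gen (k := k) x y l m hlm hx hy i i.2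
  refine ⟨v, fun i => by rw [mul_pow, mul_assoc, hv1, mul_zero], ?_⟩
  set n := u * (x + y) with hn
  have hn0 : ∀ (i : Fin l) (e : ℕ), l + m - 2 * (i : ℕ) - 1 ≤ e → n ^ e * v i = 0 := by
    intro i e he
    rw [← Nat.sub_add_cancel he, pow_add, mul_assoc, hn, mul_pow u (x + y) (l + m - 2 * (i : ℕ) - 1),
      mul_assoc, hv1, mul_zero, mul_zero]
  -- independence of the socle vectors
  have soc : ∀ c : Fin l → k, ∑ i, c i • (n ^ (l + m - 2 - 2 * (i : ℕ)) * v i) = 0 → c = 0 := by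
    intro c hc
    by_contra hne
    have hS : (Finset.univ.filter fun i => c i ≠ 0).Nonempty := by
      obtain ⟨i, hi⟩ := Function.ne_iff.1 hne
      exact ⟨i, by simpa using hi⟩
    obtain ⟨i, hi, hmax⟩ := Finset.exists_max_image _ (fun i : Fin l => i) hS
    simp only [Finset.mem_filter, Finset.mem_univ, true_and] at hi hmax
    have h2 := congrArg (fun r => x ^ (i : ℕ) * r) hc
    simp only [mul_zero, Finset.mul_sum] at h2
    rw [Finset.sum_eq_single i] at h2
    · obtain ⟨c', hc', e⟩ := hv3 i
      rw [mul_smul_comm, hn, mul_pow, mul_assoc, mul_left_comm, e] at h2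
      rw [smul_eq_zero_iff_right hi, (hu.pow _).mul_right_eq_zero, smul_eq_zero_iff_right hc'] at h2
      exact hxy h2
    · intro j _ hj
      by_cases hcj : c j = 0
      · rw [hcj]; simp
      have hlt : (j : ℕ) < i := lt_of_le_of_ne (hmax j hcj) (fun h => hj (Fin.ext h))
      rw [mul_smul_comm, hn, mul_pow, mul_assoc, mul_left_comm,
        ← Nat.sub_add_cancel (Nat.succ_le_of_lt hlt), pow_add, mul_assoc (x ^ _), Nat.succ_eq_add_one,
        hv2]
      simp
    · intro h; exact absurd (Finset.mem_univ _) h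
  intro c hc
  by_contra hne
  have hS : (Finset.univ.filter fun p => c p ≠ 0).Nonempty := by
    obtain ⟨i, hi⟩ := Function.ne_iff.1 hne
    exact ⟨i, by simpa using hi⟩
  obtain ⟨q, hq, hmax⟩ := Finset.exists_max_image _
    (fun p : (Σ i : Fin l, Fin (l + m - 2 * (i : ℕ) - 1)) => (p.2 : ℕ)) hS
  simp only [Finset.mem_filter, Finset.mem_univ, true_and] at hq hmax
  have h2 := congrArg (fun r => n ^ (q.2 : ℕ) * r) hc
  simp only [mul_zero, Finset.mul_sum] at h2
  rw [Fintype.sum_sigma] at h2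
  let c' : Fin l → k := fun i =>
    if h : (q.2 : ℕ) < l + m - 2 * (i : ℕ) - 1 then c ⟨i, ⟨q.2, h⟩⟩ else 0
  have h3 := soc c' (by
    rw [← h2]
    refine Finset.sum_congr rfl fun i _ => ?_
    have hz : ∀ j : Fin (l + m - 2 * (i : ℕ) - 1), (j : ℕ) ≠ q.2 →
        n ^ (q.2 : ℕ) * c ⟨i, j⟩ • (n ^ (l + m - 2 - 2 * (i : ℕ) - (j : ℕ)) * v i) = 0 := by
      intro j hj
      by_cases hcj : c ⟨i, j⟩ = 0
      · rw [hcj]; simp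
      have hlt : (j : ℕ) < q.2 := lt_of_le_of_ne (hmax ⟨i, j⟩ hcj) hj
      rw [mul_smul_comm, ← mul_assoc, ← pow_add, hn0 i _ (by omega), smul_zero]
    by_cases h : (q.2 : ℕ) < l + m - 2 * (i : ℕ) - 1
    · simp only [c', dif_pos h]
      rw [Finset.sum_eq_single ⟨q.2, h⟩]
      · rw [mul_smul_comm, ← mul_assoc, ← pow_add]
        congr 3
        simp only
        omega
      · intro j _ hj
        exact hz j (fun h' => hj (Fin.ext h'))
      · intro h; exact absurd (Finset.mem_univ _) h
    · simp only [c', dif_neg h, zero_smul]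
      symm
      exact Finset.sum_eq_zero fun j _ => hz j (by have := j.2; omega))
  apply hq
  have h4 := congrFun h3 q.1
  simpa [c'] using h4
end
end

theorem jordanBlock_eq {k : Type*} [Field k] (c : k) (l : ℕ) :
    jordanBlock c l = c • (1 : Matrix (Fin l) (Fin l) k) + jordanBlock 0 l := by
  ext i j
  simp only [jordanBlock, Matrix.of_apply, Matrix.add_apply, Matrix.smul_apply, Matrix.one_apply,
    smul_eq_mul, Fin.ext_iff]
  by_cases h : (j : ℕ) = i
  · simp [h]
  · simp [h, Ne.symm h]

theorem shift_pow {k : Type*} [Field k] (l p : ℕ) (i j : Fin l) :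
    ((jordanBlock (0 : k) l) ^ p) i j = if (j : ℕ) = i + p then 1 else 0 := by
  induction p generalizing j with
  | zero => simp [Matrix.one_apply, Fin.ext_iff, eq_comm]
  | succ p ih =>
    rw [pow_succ, Matrix.mul_apply]
    simp only [ih]
    have e : ∀ a : Fin l, jordanBlock (0 : k) l a j = if (j : ℕ) = a + 1 then 1 else 0 := by
      intro a
      simp only [jordanBlock, Matrix.of_apply]
      split_ifs <;> first | rfl | omega
    simp only [e]
    by_cases h : (j : ℕ) = i + (p + 1)
    · rw [if_pos h, Finset.sum_eq_single ⟨i + p, by omega⟩]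
      · simp [h]; omega
      · intro b _ hb
        rw [if_neg (fun h' => hb (Fin.ext h')), zero_mul]
      · intro h; exact absurd (Finset.mem_univ _) h
    · rw [if_neg h]
      refine Finset.sum_eq_zero fun a _ => ?_
      split_ifs <;> first | omega | simp

theorem shift_nil {k : Type*} [Field k] (l : ℕ) : (jordanBlock (0 : k) l) ^ l = 0 := by
  ext i j
  rw [shift_pow, if_neg (by omega)]; rfl

theorem kron_pow {k : Type*} [Field k] {l m : ℕ} (A : Matrix (Fin l) (Fin l) k)
    (B : Matrix (Fin m) (Fin m) k) (a : ℕ) : (A ⊗ₖ B) ^ a = (A ^ a) ⊗ₖ (B ^ a) := by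
  induction a with
  | zero => simp
  | succ a ih => rw [pow_succ, ih, ← Matrix.mul_kronecker_mul, pow_succ, pow_succ]

theorem sum_sizes (S t : ℕ) (h : 2 * t ≤ S) :
    ∑ i ∈ Finset.range t, (S - 2 * i - 1) = t * (S - t) := by
  induction t with
  | zero => simp
  | succ t ih =>
    rw [Finset.sum_range_succ, ih (by omega)]
    obtain ⟨r, rfl⟩ : ∃ r, S = 2 * (t + 1) + r := ⟨S - 2 * (t + 1), by omega⟩
    rw [show 2 * (t + 1) + r - t = t + 2 + r by omega,
      show 2 * (t + 1) + r - 2 * t - 1 = r + 1 by omega,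
      show 2 * (t + 1) + r - (t + 1) = t + 1 + r by omega]
    ring

open scoped IsMulCommutative in
/-- matrix form: existence of the chain matrix -/
theorem chain_matrix {k : Type*} [Field k] [CharZero k] (lam mu : k) (hlam : lam ≠ 0)
    (hmu : mu ≠ 0) (l m : ℕ) (hl : 0 < l) (hm : 0 < m) (hlm : l ≤ m) :
    ∃ P : Matrix (Fin l × Fin m) (Σ i : Fin l, Fin (l + m - 2 * (i : ℕ) - 1)) k,
      (∀ c, P *ᵥ c = 0 → c = 0) ∧
      (jordanBlock lam l ⊗ₖ jordanBlock mu m) * P =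
        P * Matrix.blockDiagonal' fun i : Fin l =>
          jordanBlock (lam * mu) (l + m - 2 * (i : ℕ) - 1) := by
  set X : Matrix (Fin l × Fin m) (Fin l × Fin m) k := jordanBlock (0 : k) l ⊗ₖ 1 with hX
  set Z : Matrix (Fin l × Fin m) (Fin l × Fin m) k :=
    (1 : Matrix (Fin l) (Fin l) k) ⊗ₖ jordanBlock (0 : k) m with hZ
  have hXZ : X * Z = Z * X := by
    rw [hX, hZ, ← Matrix.mul_kronecker_mul, ← Matrix.mul_kronecker_mul]; simp
  have hcomm : ∀ a ∈ ({X, Z} : Set _), ∀ b ∈ ({X, Z} : Set _), a * b = b * a := by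
    rintro a (rfl | rfl) b (rfl | rfl)
    · rfl
    · exact hXZ
    · exact hXZ.symm
    · rfl
  let S := Algebra.adjoin k ({X, Z} : Set (Matrix (Fin l × Fin m) (Fin l × Fin m) k))
  have : IsMulCommutative S := Algebra.isMulCommutative_adjoin k hcomm
  let x : S := ⟨X, Algebra.subset_adjoin (by simp)⟩
  let z : S := ⟨Z, Algebra.subset_adjoin (by simp)⟩
  have hXp : ∀ a b, X ^ a * Z ^ b = (jordanBlock (0 : k) l ^ a) ⊗ₖ (jordanBlock (0 : k) m ^ b) := by
    intro a b
    rw [hX, hZ, kron_pow, kron_pow, ← Matrix.mul_kronecker_mul]; simp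
  have hx : x ^ l = 0 := by
    apply Subtype.ext
    have := hXp l 0
    rw [shift_nil] at this
    simpa [x] using this
  have hz : z ^ m = 0 := by
    apply Subtype.ext
    have := hXp 0 m
    rw [shift_nil] at this
    simpa [z] using this
  let w : Fin l × Fin m := (⟨l - 1, by omega⟩, ⟨m - 1, by omega⟩)
  have hu : IsUnit (algebraMap k S mu + z) := by
    refine IsNilpotent.isUnit_add_left_of_commute ⟨m, hz⟩ ?_ (Commute.all _ _)
    exact (IsUnit.mk0 mu hmu).map _
  obtain ⟨u, hu'⟩ := hu
  let y : S := algebraMap k S lam * ((u⁻¹ : Sˣ) : S) * z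
  have hy : y ^ m = 0 := by simp only [y, mul_pow, hz, mul_zero]
  have hxz : x ^ (l - 1) * z ^ (m - 1) ≠ 0 := by
    intro h
    have h1 : X ^ (l - 1) * Z ^ (m - 1) = 0 := by simpa [x, z] using congrArg Subtype.val h
    rw [hXp] at h1
    have h2 := congrFun (congrFun h1 (⟨0, hl⟩, ⟨0, hm⟩)) w
    simp [Matrix.kroneckerMap_apply, shift_pow, w] at h2
  have hxy : x ^ (l - 1) * y ^ (m - 1) ≠ 0 := by
    have e : x ^ (l - 1) * y ^ (m - 1) =
      (algebraMap k S lam * ((u⁻¹ : Sˣ) : S)) ^ (m - 1) * (x ^ (l - 1) * z ^ (m - 1)) := by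
      simp only [y, mul_pow]; ring
    rw [e]
    have : IsUnit (algebraMap k S lam * ((u⁻¹ : Sˣ) : S)) :=
      ((IsUnit.mk0 lam hlam).map _).mul u⁻¹.isUnit
    rw [Ne, (this.pow _).mul_right_eq_zero]
    exact hxz
  have hN : (u : S) * (x + y) = algebraMap k S mu * x + z * x + algebraMap k S lam * z := by
    have : (u : S) * y = algebraMap k S lam * z := by
      simp only [y]
      rw [show (u : S) * (algebraMap k S lam * ((u⁻¹ : Sˣ) : S) * z) =
        ((u : S) * ((u⁻¹ : Sˣ) : S)) * (algebraMap k S lam * z) by ring, Units.mul_inv, one_mul]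
    rw [mul_add, this, hu']; ring
  obtain ⟨v, hv, hind⟩ := chains (k := k) x y (u : S) u.isUnit l m hlm hx hy hxy
  set n : S := (u : S) * (x + y) with hn
  have hA : jordanBlock lam l ⊗ₖ jordanBlock mu m =
      ((algebraMap k S (lam * mu) + n : S) : Matrix _ _ k) := by
    have e1 : jordanBlock lam l ⊗ₖ jordanBlock mu m =
        (lam • 1 + X) * (mu • 1 + Z) := by
      have a1 : lam • 1 + X = jordanBlock lam l ⊗ₖ (1 : Matrix (Fin m) (Fin m) k) := by
        rw [jordanBlock_eq lam, Matrix.add_kronecker, Matrix.smul_kronecker, Matrix.one_kronecker_one]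
      have a2 : mu • 1 + Z = (1 : Matrix (Fin l) (Fin l) k) ⊗ₖ jordanBlock mu m := by
        rw [jordanBlock_eq mu, Matrix.kronecker_add, Matrix.kronecker_smul, Matrix.one_kronecker_one]
      rw [a1, a2, ← Matrix.mul_kronecker_mul]; simp
    have e2 : algebraMap k S (lam * mu) + n =
        (algebraMap k S lam + x) * (algebraMap k S mu + z) := by
      rw [hN, map_mul]; ring
    rw [e1, e2]
    simp [x, z, Algebra.algebraMap_eq_smul_one]
  -- the column map is injective
  have hinj : ∀ r : S, (∀ q, (r : Matrix (Fin l × Fin m) (Fin l × Fin m) k) q w = 0) → r = 0 := by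
    intro r hr
    apply Subtype.ext
    ext q p
    have hc : (r : Matrix _ _ k) * (X ^ (l - 1 - (p.1 : ℕ)) * Z ^ (m - 1 - (p.2 : ℕ))) =
        (X ^ (l - 1 - (p.1 : ℕ)) * Z ^ (m - 1 - (p.2 : ℕ))) * (r : Matrix _ _ k) :=
      congrArg Subtype.val (mul_comm r (x ^ (l - 1 - (p.1 : ℕ)) * z ^ (m - 1 - (p.2 : ℕ))))
    have h1 := congrFun (congrFun hc q) w
    rw [Matrix.mul_apply, Matrix.mul_apply] at h1
    simp only [hr, mul_zero, Finset.sum_const_zero] at h1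
    rw [Finset.sum_eq_single p] at h1
    · rw [hXp, Matrix.kroneckerMap_apply, shift_pow, shift_pow,
        if_pos (by simp only [w]; omega), if_pos (by simp only [w]; omega)] at h1
      simpa using h1
    · intro b _ hb
      rw [hXp, Matrix.kroneckerMap_apply, shift_pow, shift_pow]
      by_cases c1 : b.1 = p.1
      · rw [if_neg (c := _ = (b.2 : ℕ) + _)]
        · simp
        · intro c2
          apply hb
          refine Prod.ext c1 (Fin.ext ?_)
          simp only [w] at c2
          omega
      · rw [if_neg]
        · simp
        · intro c2
          apply c1
          refine Fin.ext ?_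
          simp only [w] at c2
          omega
    · intro h; exact absurd (Finset.mem_univ _) h
  refine ⟨Matrix.of fun q p =>
    ((n ^ (l + m - 2 - 2 * (p.1 : ℕ) - (p.2 : ℕ)) * v p.1 : S) : Matrix _ _ k) q w, ?_, ?_⟩
  · intro c hc
    apply hind
    apply hinj
    intro q
    have := congrFun hc q
    simp only [Matrix.mulVec, dotProduct, Matrix.of_apply, Pi.zero_apply] at this
    rw [← this, AddSubmonoidClass.coe_finsetSum, Matrix.sum_apply]
    refine Finset.sum_congr rfl fun p _ => ?_
    exact mul_comm (c p) _
  · ext q ⟨i, j⟩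
    have lhs : ((jordanBlock lam l ⊗ₖ jordanBlock mu m) * (Matrix.of fun (q : Fin l × Fin m)
        (p : Σ i : Fin l, Fin (l + m - 2 * (i : ℕ) - 1)) =>
        ((n ^ (l + m - 2 - 2 * (p.1 : ℕ) - (p.2 : ℕ)) * v p.1 : S) :
          Matrix (Fin l × Fin m) (Fin l × Fin m) k) q w)) q ⟨i, j⟩
        = (((algebraMap k S (lam * mu) + n) * (n ^ (l + m - 2 - 2 * (i : ℕ) - (j : ℕ)) * v i) : S) :
          Matrix (Fin l × Fin m) (Fin l × Fin m) k) q w := by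
      rw [hA]; rfl
    rw [lhs, Matrix.mul_apply, Fintype.sum_sigma, Finset.sum_eq_single i]
    rotate_left
    · intro b _ hb
      refine Finset.sum_eq_zero fun j' _ => ?_
      rw [Matrix.blockDiagonal'_apply_ne _ _ _ hb, mul_zero]
    · intro h; exact absurd (Finset.mem_univ _) h
    simp only [Matrix.blockDiagonal'_apply_eq, Matrix.of_apply]
    rw [jordanBlock_eq]
    simp only [Matrix.add_apply, mul_add, Finset.sum_add_distrib]
    have s1 : ∀ a b, jordanBlock (0 : k) (l + m - 2 * (i : ℕ) - 1) a b =
        if (b : ℕ) = a + 1 then 1 else 0 := by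
      intro a b
      have := shift_pow (k := k) _ 1 a b
      rwa [pow_one] at this
    rw [add_mul, AddMemClass.coe_add, Matrix.add_apply]
    congr 1
    · rw [Finset.sum_eq_single j]
      · rw [← Algebra.smul_def]
        simp [mul_comm]
      · intro b _ hb
        simp [Matrix.one_apply_ne hb]
      · intro h; exact absurd (Finset.mem_univ _) h
    · simp only [s1]
      by_cases hj : (j : ℕ) = 0
      · rw [Finset.sum_eq_zero]
        · rw [← mul_assoc, ← pow_succ', show l + m - 2 - 2 * (i : ℕ) - (j : ℕ) + 1 =
            l + m - 2 * (i : ℕ) - 1 by omega, hv]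
          rfl
        · intro b _
          rw [if_neg (by omega), mul_zero]
      · rw [Finset.sum_eq_single ⟨(j : ℕ) - 1, by omega⟩]
        · rw [if_pos (by simp only; omega), mul_one, ← mul_assoc, ← pow_succ']
          simp only
          rw [show l + m - 2 - 2 * (i : ℕ) - (j : ℕ) + 1 =
            l + m - 2 - 2 * (i : ℕ) - ((j : ℕ) - 1) by omega]
        · intro b _ hb
          rw [if_neg, mul_zero]
          intro h
          exact hb (Fin.ext (by simp only; omega))
        · intro h; exact absurd (Finset.mem_univ _) h

theorem stmt0 {k : Type*} [Field k] [CharZero k] (lam mu : k) (hlam : lam ≠ 0)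
    (hmu : mu ≠ 0) (l m : ℕ) (hl : 0 < l) (hm : 0 < m) (hlm : l ≤ m) :
    MatSimilar (jordanBlock lam l ⊗ₖ jordanBlock mu m)
      (Matrix.blockDiagonal' fun i : Fin l =>
        jordanBlock (lam * mu) (l + m - 2 * (i : ℕ) - 1)) := by
  obtain ⟨P, hP, hPB⟩ := chain_matrix lam mu hlam hmu l m hl hm hlm
  have hcard : Fintype.card (Fin l × Fin m) =
      Fintype.card (Σ i : Fin l, Fin (l + m - 2 * (i : ℕ) - 1)) := by
    rw [Fintype.card_prod, Fintype.card_sigma, Fintype.card_fin, Fintype.card_fin]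
    simp only [Fintype.card_fin]
    rw [Fin.sum_univ_eq_sum_range (fun i => l + m - 2 * i - 1) l, sum_sizes _ _ (by omega),
      Nat.add_sub_cancel_left]
  let e := Fintype.equivOfCardEq hcard
  have hT : IsUnit (P.submatrix e.symm id) := by
    rw [← Matrix.mulVec_injective_iff_isUnit]
    have : Function.Injective (Matrix.mulVecLin (P.submatrix e.symm id)) := by
      rw [← LinearMap.ker_eq_bot, LinearMap.ker_eq_bot']
      intro c hc
      apply hP
      funext q
      have := congrFun hc (e q)
      simpa [Matrix.mulVec, dotProduct] using this
    exact this
  refine ⟨e, P.submatrix e.symm id, hT, ?_⟩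
  have h1 : Matrix.reindex e e (jordanBlock lam l ⊗ₖ jordanBlock mu m) * P.submatrix e.symm id =
      P.submatrix e.symm id * Matrix.blockDiagonal' fun i : Fin l =>
        jordanBlock (lam * mu) (l + m - 2 * (i : ℕ) - 1) := by
    rw [Matrix.reindex_apply, Matrix.submatrix_mul_equiv, hPB]
    rfl
  rw [← h1, Matrix.mul_assoc, Matrix.mul_nonsing_inv _ ((Matrix.isUnit_iff_isUnit_det _).1 hT),
    Matrix.mul_one]
end

section
/- Let F be an algebraic field extension of a field k, let A be an associative unital k-algebra, and let V and W be A-modules that are finite-dimensional as k-vector spaces. If the base-changed modules F ⊗_k V and F ⊗_k W are isomorphic as modules over the F-algebra F ⊗_k A, then V and W are isomorphic as A-modules. -/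
open TensorProduct

/-- The action of an element `a` of a `k`-algebra `A` on an `A`-module `V`,
as a `k`-linear endomorphism of `V`. -/
def actionMap (k : Type*) {A V : Type*} [Field k] [Ring A] [Algebra k A]
    [AddCommGroup V] [Module k V] [Module A V] [SMulCommClass A k V] (a : A) :
    V →ₗ[k] V where
  toFun v := a • v
  map_add' := smul_add a
  map_smul' c v := smul_comm a c v

/-- Contraction of the left factor by a functional. -/
noncomputable def contr {k F : Type*} (U : Type*) [Field k] [Field F] [Algebra k F]
    [AddCommGroup U] [Module k U] (l : F →ₗ[k] k) : F ⊗[k] U →ₗ[k] U :=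
  (TensorProduct.lid k U).toLinearMap ∘ₗ LinearMap.rTensor U l

@[simp] theorem contr_tmul {k F U : Type*} [Field k] [Field F] [Algebra k F]
    [AddCommGroup U] [Module k U] (l : F →ₗ[k] k) (c : F) (u : U) :
    contr U l (c ⊗ₜ u) = l c • u := by
  simp [contr]

theorem contr_baseChange {k F U : Type*} [Field k] [Field F] [Algebra k F]
    [AddCommGroup U] [Module k U] (l : F →ₗ[k] k) (f : U →ₗ[k] U) (z : F ⊗[k] U) :
    contr U l (LinearMap.baseChange F f z) = f (contr U l z) := by
  induction z with
  | zero => simp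
  | tmul c u => simp
  | add x y hx hy => simp [hx, hy]

theorem decomp {k : Type*} {F : Type*} {X U : Type*} [Field k] [Field F] [Algebra k F]
    [AddCommGroup X] [Module k X] [FiniteDimensional k X]
    [AddCommGroup U] [Module k U] (g : X →ₗ[k] F ⊗[k] U) :
    ∃ (n : ℕ) (c : Fin n → F) (l : Fin n → (F →ₗ[k] k)),
      ∀ x, g x = ∑ i, c i ⊗ₜ[k] contr U (l i) (g x) := by
  classical
  let B := Module.Basis.ofVectorSpace k F
  let D := Module.finBasis k X
  have key : ∀ z : F ⊗[k] U, ∃ s : Finset (Module.Basis.ofVectorSpaceIndex k F),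
      ∀ t, s ⊆ t → z = ∑ i ∈ t, B i ⊗ₜ[k] contr U (B.coord i) z := by
    intro z
    induction z with
    | zero => exact ⟨∅, by simp⟩
    | tmul c u =>
      refine ⟨(B.repr c).support, fun t ht => ?_⟩
      simp only [contr_tmul, TensorProduct.tmul_smul]
      rw [← Finset.sum_subset ht]
      · conv_lhs => rw [← B.linearCombination_repr c, Finsupp.linearCombination_apply, Finsupp.sum,
          TensorProduct.sum_tmul]
        simp [TensorProduct.smul_tmul']
      · intro i _ hi
        simp only [Finsupp.mem_support_iff, not_not] at hi
        simp [hi]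
    | add x y hx hy =>
      obtain ⟨s, hs⟩ := hx
      obtain ⟨s', hs'⟩ := hy
      refine ⟨s ∪ s', fun t ht => ?_⟩
      conv_lhs => rw [hs t (Finset.union_subset_left ht), hs' t (Finset.union_subset_right ht)]
      simp [TensorProduct.tmul_add, Finset.sum_add_distrib]
  choose S hS using fun j => key (g (D j))
  let t := Finset.univ.biUnion S
  have h1 : g = ∑ i ∈ t, (TensorProduct.mk k F U (B i)) ∘ₗ contr U (B.coord i) ∘ₗ g := by
    refine D.ext fun j => ?_
    rw [LinearMap.sum_apply]
    exact hS j t (Finset.subset_biUnion_of_mem S (Finset.mem_univ j))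
  refine ⟨t.card, fun i => B (t.equivFin.symm i), fun i => B.coord (t.equivFin.symm i), fun x => ?_⟩
  have h2 : g x = ∑ i ∈ t, B i ⊗ₜ[k] contr U (B.coord i) (g x) := by
    conv_lhs => rw [h1]
    rw [LinearMap.sum_apply]; rfl
  rw [t.equivFin.symm.sum_comp (fun i => B (i : Module.Basis.ofVectorSpaceIndex k F) ⊗ₜ[k] contr U (B.coord i) (g x))]
  rw [Finset.sum_coe_sort t (fun i => B i ⊗ₜ[k] contr U (B.coord i) (g x))]
  exact h2

/-- `A`-linear maps vanishing on `K`. -/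
def homVan (k A : Type*) {X : Type*} (U : Type*) [Field k] [Ring A] [Algebra k A]
    [AddCommGroup X] [Module k X] [Module A X]
    [AddCommGroup U] [Module k U] [Module A U] [SMulCommClass A k U] (K : Set X) :
    Submodule k (X →ₗ[k] U) where
  carrier := {f | (∀ (a : A) (x : X), f (a • x) = a • f x) ∧ ∀ x ∈ K, f x = 0}
  zero_mem' := by simp
  add_mem' := by
    rintro f g ⟨hf, hf'⟩ ⟨hg, hg'⟩
    exact ⟨fun a x => by simp [hf, hg], fun x hx => by simp [hf' x hx, hg' x hx]⟩
  smul_mem' := by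
    rintro c f ⟨hf, hf'⟩
    exact ⟨fun a x => by simp [hf, smul_comm a c], fun x hx => by simp [hf' x hx]⟩

theorem finrank_le {k F A X V W : Type*} [Field k] [Field F] [Algebra k F]
    [Ring A] [Algebra k A]
    [AddCommGroup X] [Module k X] [Module A X] [FiniteDimensional k X]
    [AddCommGroup V] [Module k V] [Module A V]
    [SMulCommClass A k V] [FiniteDimensional k V]
    [AddCommGroup W] [Module k W] [Module A W]
    [SMulCommClass A k W] [FiniteDimensional k W]
    (e : (F ⊗[k] V) ≃ₗ[F] F ⊗[k] W)
    (he : ∀ (a : A) (z : F ⊗[k] V),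
      e (LinearMap.baseChange F (actionMap k a) z) =
        LinearMap.baseChange F (actionMap k a) (e z)) (K : Set X) :
    Module.finrank k (homVan k A V K) ≤ Module.finrank k (homVan k A W K) := by
  classical
  let b := Module.finBasis k (homVan k A V K)
  let b' := Module.finBasis k (homVan k A W K)
  let j : (X →ₗ[k] W) →ₗ[k] (X →ₗ[k] F ⊗[k] W) := LinearMap.llcomp k X W (F ⊗[k] W) (TensorProduct.mk k F W 1)
  let g : Fin (Module.finrank k (homVan k A V K)) → (X →ₗ[k] F ⊗[k] W) := fun i =>
    (e.toLinearMap.restrictScalars k) ∘ₗ (TensorProduct.mk k F V 1) ∘ₗ (b i : X →ₗ[k] V)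
  have hli : LinearIndependent F g := by
    refine (Fintype.linearIndependent_iff (R := F) (M := X →ₗ[k] F ⊗[k] W) (v := g)).2 ?_
    intro c hc i
    rw [← Module.forall_dual_apply_eq_zero_iff k]
    intro l
    have h1 : ∑ i, l (c i) • b i = 0 := by
      ext x
      have h2 := LinearMap.congr_fun hc x
      have h3 : e (∑ i, c i ⊗ₜ[k] (b i : X →ₗ[k] V) x) = 0 := by
        rw [← LinearMap.zero_apply (σ₁₂ := RingHom.id k) x, ← h2, map_sum, LinearMap.sum_apply]
        refine Finset.sum_congr rfl fun i _ => ?_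
        simp only [g, LinearMap.smul_apply, LinearMap.comp_apply, TensorProduct.mk_apply,
          LinearMap.restrictScalars_apply, LinearEquiv.coe_coe]
        rw [← map_smul, TensorProduct.smul_tmul', smul_eq_mul, mul_one]
      rw [e.map_eq_zero_iff] at h3
      have h4 := congrArg (contr V l) h3
      simpa using h4
    exact Fintype.linearIndependent_iff.1 b.linearIndependent _ h1 i
  have hspan : Submodule.span F (Set.range g) ≤ Submodule.span F (Set.range fun i => j (b' i)) := by
    rw [Submodule.span_le]
    rintro _ ⟨i, rfl⟩
    have hj : ∀ f ∈ homVan k A W K, j f ∈ Submodule.span F (Set.range fun i => j (b' i)) := by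
      intro f hf
      have h1 := congrArg (fun y : homVan k A W K => j y) (b'.sum_repr ⟨f, hf⟩)
      simp only [Submodule.coe_sum, map_sum, Submodule.coe_smul, map_smul] at h1
      rw [← h1]
      refine Submodule.sum_mem _ fun i _ => ?_
      rw [← algebraMap_smul F]
      exact Submodule.smul_mem _ _ (Submodule.subset_span ⟨i, rfl⟩)
    obtain ⟨n, c, l, h⟩ := decomp (g i)
    have h1 : g i = ∑ m, c m • j (contr W (l m) ∘ₗ g i) := by
      ext x
      rw [LinearMap.sum_apply]
      refine (h x).trans (Finset.sum_congr rfl fun m _ => ?_)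
      simp [j, TensorProduct.smul_tmul']
    rw [SetLike.mem_coe, h1]
    refine Submodule.sum_mem _ fun m _ => Submodule.smul_mem _ _ (hj _ ⟨fun a x => ?_, fun x hx => ?_⟩)
    · have h3 := he a (1 ⊗ₜ (b i : X →ₗ[k] V) x)
      have h4 := congrArg (contr W (l m)) h3
      rw [contr_baseChange, LinearMap.baseChange_tmul] at h4
      simp only [g, LinearMap.comp_apply, (b i).2.1 a x]
      exact h4
    · simp [g, (b i).2.2 x hx]
  have hfin : Module.Finite F (Submodule.span F (Set.range fun i => j (b' i))) :=
    Module.Finite.span_of_finite F (Set.finite_range _)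
  have := Submodule.finrank_mono hspan
  rw [finrank_span_eq_card hli] at this
  refine (Fintype.card_fin _).symm.le.trans (this.trans ((finrank_range_le_card _).trans (Fintype.card_fin _).le))

theorem infinite_case {k F A V W : Type*} [Field k] [Infinite k] [Field F] [Algebra k F]
    [Ring A] [Algebra k A]
    [AddCommGroup V] [Module k V] [Module A V]
    [SMulCommClass A k V] [FiniteDimensional k V]
    [AddCommGroup W] [Module k W] [Module A W]
    [SMulCommClass A k W] [FiniteDimensional k W]
    (e : (F ⊗[k] V) ≃ₗ[F] F ⊗[k] W)
    (he : ∀ (a : A) (z : F ⊗[k] V),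
      e (LinearMap.baseChange F (actionMap k a) z) =
        LinearMap.baseChange F (actionMap k a) (e z))
    (hd : Module.finrank k V = Module.finrank k W) :
    ∃ f ∈ homVan k A W (∅ : Set V), Function.Bijective f := by
  classical
  obtain ⟨n, c, l, h⟩ := decomp ((e.toLinearMap.restrictScalars k) ∘ₗ (TensorProduct.mk k F V 1))
  let φ : Fin n → (V →ₗ[k] W) := fun i =>
    contr W (l i) ∘ₗ (e.toLinearMap.restrictScalars k) ∘ₗ (TensorProduct.mk k F V 1)
  have hφ : ∀ i, φ i ∈ homVan k A W (∅ : Set V) := by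
    refine fun i => ⟨fun a x => ?_, by simp⟩
    have h4 := congrArg (contr W (l i)) (he a (1 ⊗ₜ x))
    rw [contr_baseChange, LinearMap.baseChange_tmul] at h4
    exact h4
  have hsum : e.toLinearMap = ∑ i, c i • LinearMap.baseChange F (φ i) := by
    ext x
    refine (h x).trans ?_
    simp [φ, TensorProduct.smul_tmul']
  let bV := Module.finBasis k V
  let bW := (Module.finBasis k W).reindex (finCongr hd.symm)
  let M : Fin n → Matrix (Fin (Module.finrank k V)) (Fin (Module.finrank k V)) k :=
    fun i => LinearMap.toMatrix bV bW (φ i)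
  let P : MvPolynomial (Fin n) k := Matrix.det (∑ i, (MvPolynomial.X i : MvPolynomial (Fin n) k) • (M i).map MvPolynomial.C)
  have hP : P ≠ 0 := by
    intro h0
    have h1 : MvPolynomial.aeval c P = 0 := by rw [h0, map_zero]
    have h2 : MvPolynomial.aeval c P =
        (LinearMap.toMatrix (Algebra.TensorProduct.basis F bV) (Algebra.TensorProduct.basis F bW) e.toLinearMap).det := by
      rw [hsum, AlgHom.map_det]
      congr 1
      ext p q
      simp [M, Matrix.sum_apply, LinearMap.toMatrix_baseChange]
    rw [h2] at h1
    exact (LinearEquiv.isUnit_det e (Algebra.TensorProduct.basis F bV) (Algebra.TensorProduct.basis F bW)).ne_zero h1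
  obtain ⟨x, hx⟩ : ∃ x, MvPolynomial.eval x P ≠ 0 := by
    by_contra! hcon
    exact hP (MvPolynomial.funext fun x => by simp [hcon x])
  have hx2 : MvPolynomial.eval x P = (LinearMap.toMatrix bV bW (∑ i, x i • φ i)).det := by
    rw [RingHom.map_det]
    congr 1
    ext p q
    simp [M, Matrix.sum_apply]
  refine ⟨∑ i, x i • φ i, Submodule.sum_mem _ fun i _ => Submodule.smul_mem _ _ (hφ i), ?_⟩
  rw [hx2] at hx
  exact (LinearEquiv.ofIsUnitDet (isUnit_iff_ne_zero.2 hx)).bijective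

theorem card_fib {k A V U : Type*} [Field k] [Ring A] [Algebra k A]
    [AddCommGroup V] [Module k V] [Module A V] [Finite V]
    [AddCommGroup U] [Module k U] [Module A U] [SMulCommClass A k U]
    [Finite (V →ₗ[k] U)] (K : Set V) :
    Nat.card (homVan k A U K) =
      ∑ᶠ K' ∈ {K' : Set V | K ⊆ K'},
        Nat.card {f : V →ₗ[k] U // f ∈ homVan k A U (∅ : Set V) ∧ {v | f v = 0} = K'} := by
  classical
  have := Fintype.ofFinite V
  have := Fintype.ofFinite (V →ₗ[k] U)
  rw [finsum_mem_eq_finite_toFinset_sum _ (Set.toFinite _)]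
  have h0 : Nat.card (homVan k A U K) = (Finset.univ.filter (· ∈ homVan k A U K)).card := by
    rw [← Fintype.card_subtype, ← Nat.card_eq_fintype_card]
  rw [h0, Finset.card_eq_sum_card_fiberwise (f := fun f : V →ₗ[k] U => {v | f v = 0})
    (t := (Set.toFinite {K' : Set V | K ⊆ K'}).toFinset)]
  · refine Finset.sum_congr rfl fun K' hK' => ?_
    rw [Nat.card_eq_fintype_card, Fintype.card_subtype, Finset.filter_filter]
    congr 1
    ext f
    simp only [Set.Finite.mem_toFinset, Set.mem_ofPred_eq] at hK'
    simp only [Finset.mem_filter, Finset.mem_univ, true_and]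
    refine and_congr_left fun h => ⟨fun h1 => ⟨h1.1, by simp⟩, fun h1 => ⟨h1.1, fun x hx => ?_⟩⟩
    have := hK' hx
    rw [← h] at this
    exact this
  · intro f hf
    simp only [Finset.coe_filter, Finset.mem_univ, true_and, Set.mem_ofPred_eq] at hf
    simp only [Set.Finite.coe_toFinset, Set.mem_ofPred_eq]
    exact fun x hx => hf.2 x hx

theorem finite_case {k F A V W : Type*} [Field k] [Finite k] [Field F] [Algebra k F]
    [Ring A] [Algebra k A]
    [AddCommGroup V] [Module k V] [Module A V]
    [SMulCommClass A k V] [FiniteDimensional k V]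
    [AddCommGroup W] [Module k W] [Module A W]
    [SMulCommClass A k W] [FiniteDimensional k W]
    (e : (F ⊗[k] V) ≃ₗ[F] F ⊗[k] W)
    (he : ∀ (a : A) (z : F ⊗[k] V),
      e (LinearMap.baseChange F (actionMap k a) z) =
        LinearMap.baseChange F (actionMap k a) (e z))
    (hd : Module.finrank k V = Module.finrank k W) :
    ∃ f ∈ homVan k A W (∅ : Set V), Function.Bijective f := by
  classical
  have he' : ∀ (a : A) (z : F ⊗[k] W),
      e.symm (LinearMap.baseChange F (actionMap k a) z) =
        LinearMap.baseChange F (actionMap k a) (e.symm z) := by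
    intro a z
    rw [e.symm_apply_eq, he, e.apply_symm_apply]
  have : Finite V := Module.finite_of_finite k
  have : Finite (V →ₗ[k] V) := Module.finite_of_finite k
  have : Finite (V →ₗ[k] W) := Module.finite_of_finite k
  have hcard : ∀ K : Set V, Nat.card (homVan k A V K) = Nat.card (homVan k A W K) := by
    intro K
    rw [Module.natCard_eq_pow_finrank (K := k), Module.natCard_eq_pow_finrank (K := k) (V := homVan k A W K),
      le_antisymm (finrank_le e he K) (finrank_le e.symm he' K)]
  have key : ∀ K : Set V,
      Nat.card {f : V →ₗ[k] V // f ∈ homVan k A V (∅ : Set V) ∧ {v | f v = 0} = K} =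
      Nat.card {f : V →ₗ[k] W // f ∈ homVan k A W (∅ : Set V) ∧ {v | f v = 0} = K} := by
    intro K
    induction K using WellFoundedGT.induction with
    | ind K ih =>
    have h := hcard K
    have hK : {K' : Set V | K ⊆ K'} = insert K {K' | K < K'} := by
      ext K'
      simp only [Set.mem_ofPred_eq, Set.mem_insert_iff]
      rw [eq_comm (a := K')]
      exact le_iff_eq_or_lt
    rw [card_fib, card_fib, hK, finsum_mem_insert _ (by simp) (Set.toFinite _),
      finsum_mem_insert _ (by simp) (Set.toFinite _), finsum_mem_congr (s := {K' | K < K'}) rfl (fun K' hK' => ih K' hK')] at h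
    exact Nat.add_right_cancel h
  have h1 : 0 < Nat.card {f : V →ₗ[k] V // f ∈ homVan k A V (∅ : Set V) ∧ {v | f v = 0} = {0}} := by
    have : Nonempty {f : V →ₗ[k] V // f ∈ homVan k A V (∅ : Set V) ∧ {v | f v = 0} = {0}} :=
      ⟨LinearMap.id, ⟨by simp, by simp⟩, by ext; simp⟩
    exact Nat.card_pos
  rw [key] at h1
  obtain ⟨⟨f, hf, hf0⟩⟩ := (Nat.card_pos_iff.1 h1).1
  have hinj : Function.Injective f := by
    rw [injective_iff_map_eq_zero]
    intro v hv
    have : v ∈ {v | f v = 0} := hv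
    rwa [hf0] at this
  exact ⟨f, hf, hinj, (LinearMap.injective_iff_surjective_of_finrank_eq_finrank hd).1 hinj⟩

theorem stmt3 {k F A V W : Type*} [Field k] [Field F] [Algebra k F]
    [Algebra.IsAlgebraic k F] [Ring A] [Algebra k A]
    [AddCommGroup V] [Module k V] [Module A V] [IsScalarTower k A V]
    [SMulCommClass A k V] [FiniteDimensional k V]
    [AddCommGroup W] [Module k W] [Module A W] [IsScalarTower k A W]
    [SMulCommClass A k W] [FiniteDimensional k W]
    (e : (F ⊗[k] V) ≃ₗ[F] F ⊗[k] W)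
    (he : ∀ (a : A) (z : F ⊗[k] V),
      e (LinearMap.baseChange F (actionMap k a) z) =
        LinearMap.baseChange F (actionMap k a) (e z)) :
    Nonempty (V ≃ₗ[A] W) := by
  have hd : Module.finrank k V = Module.finrank k W := by
    have := e.finrank_eq
    rwa [Module.finrank_baseChange, Module.finrank_baseChange] at this
  obtain ⟨f, hf, hb⟩ : ∃ f ∈ homVan k A W (∅ : Set V), Function.Bijective f := by
    cases finite_or_infinite k
    · exact finite_case e he hd
    · exact infinite_case e he hd
  exact ⟨LinearEquiv.ofBijective
    ({ toFun := f, map_add' := f.map_add, map_smul' := hf.1 } : V →ₗ[A] W) hb⟩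
end

section
/- Let k be a field of characteristic p > 0, let s be a positive integer, and write s = tp + r with integers t ≥ 0 and 0 ≤ r < p. Then the p-th power J_1(s)^p of the unipotent Jordan block J_1(s) is similar to the block-diagonal direct sum of r copies of J_1(t+1) and (p − r) copies of J_1(t). -/
open Matrix Kronecker

theorem s13_nil_pow {k : Type*} [Field k] (s m : ℕ) :
    (jordanBlock (0 : k) s) ^ m =
      Matrix.of fun i j : Fin s => if (j : ℕ) = (i : ℕ) + m then (1 : k) else 0 := by
  induction m with
  | zero =>
    ext i j
    simp [Matrix.one_apply, Fin.ext_iff, eq_comm]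
  | succ m ih =>
    rw [pow_succ', ih]
    ext i j
    rw [Matrix.mul_apply]
    simp only [jordanBlock, Matrix.of_apply]
    by_cases h : (i : ℕ) + 1 < s
    · rw [Finset.sum_eq_single (⟨(i : ℕ) + 1, h⟩ : Fin s)]
      · have : (i : ℕ) + 1 + m = i + (m + 1) := by omega
        simp [this]
      · intro b _ hb
        have : (b : ℕ) ≠ i + 1 := fun h' => hb (Fin.ext h')
        simp [this]
      · simp
    · rw [Finset.sum_eq_zero]
      · rw [if_neg]
        have := j.2
        omega
      · intro b _
        have h1 : (b : ℕ) ≠ i + 1 := by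
          have := b.2
          omega
        simp [h1]

theorem s13_one_eq {k : Type*} [Field k] (s : ℕ) :
    jordanBlock (1 : k) s = jordanBlock (0 : k) s + 1 := by
  ext i j
  simp only [jordanBlock, Matrix.of_apply, Matrix.add_apply, Matrix.one_apply, Fin.ext_iff]
  by_cases h : (j : ℕ) = i
  · simp [h]
  · simp [h, Ne.symm h]

theorem s13_divmod {p a b a' b' : ℕ} (hb : b < p) (hb' : b' < p)
    (h : a * p + b = a' * p + b') : a = a' ∧ b = b' := by
  have h1 : (a * p + b) / p = a := by
    rw [mul_comm, Nat.mul_add_div (by omega), Nat.div_eq_of_lt hb]; rfl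
  have h2 : (a' * p + b') / p = a' := by
    rw [mul_comm, Nat.mul_add_div (by omega), Nat.div_eq_of_lt hb']; rfl
  have : a = a' := by rw [← h1, h, h2]
  subst this
  exact ⟨rfl, by omega⟩

theorem stmt13 {k : Type*} [Field k] (p : ℕ) (hp : 0 < p) [CharP k p]
    (s t r : ℕ) (hs : 0 < s) (hstr : s = t * p + r) (hr : r < p) :
    MatSimilar ((jordanBlock (1 : k) s) ^ p)
      (Matrix.blockDiagonal'
        (fun i : Fin r ⊕ Fin (p - r) =>
          jordanBlock (1 : k) (Sum.elim (fun _ => t + 1) (fun _ => t) i))) := by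
  have hprime : p.Prime := (CharP.char_is_prime_or_zero k p).resolve_right hp.ne'
  haveI : Fact p.Prime := ⟨hprime⟩
  haveI : Nonempty (Fin s) := ⟨⟨0, hs⟩⟩
  have hpow : (jordanBlock (1 : k) s) ^ p = Matrix.of fun i j : Fin s =>
      if (j : ℕ) = i then (1 : k) else if (j : ℕ) = (i : ℕ) + p then 1 else 0 := by
    rw [s13_one_eq, add_pow_char_of_commute _ (Commute.one_right _), one_pow, s13_nil_pow]
    ext i j
    simp only [Matrix.of_apply, Matrix.add_apply, Matrix.one_apply, Fin.ext_iff]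
    by_cases h : (j : ℕ) = i
    · simp [h, hp.ne']
    · simp [h, Ne.symm h]
  let g : Fin r ⊕ Fin (p - r) → ℕ := Sum.elim (fun c => (c : ℕ)) (fun c => r + (c : ℕ))
  have hg : ∀ i, g i < p := by
    rintro (c | c)
    · have := c.2
      simp only [g, Sum.elim_inl]; omega
    · have := c.2
      simp only [g, Sum.elim_inr]; omega
  have hginj : ∀ i j, g i = g j → i = j := by
    rintro (c | c) (d | d) h <;> have := c.2 <;> have := d.2 <;>
      simp only [g, Sum.elim_inl, Sum.elim_inr] at h
    · exact congrArg _ (Fin.ext h)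
    · omega
    · omega
    · exact congrArg _ (Fin.ext (by omega))
  let F := (i : Fin r ⊕ Fin (p - r)) × Fin (Sum.elim (fun _ => t + 1) (fun _ => t) i)
  have hlt : ∀ x : F, (x.2 : ℕ) * p + g x.1 < s := by
    rintro ⟨c | c, q⟩
    · have h1 : (q : ℕ) < t + 1 := q.2
      have h2 : (q : ℕ) * p ≤ t * p := Nat.mul_le_mul_right _ (by omega)
      have := c.2
      simp only [g, Sum.elim_inl]; omega
    · have h1 : (q : ℕ) < t := q.2
      have h2 : ((q : ℕ) + 1) * p ≤ t * p := Nat.mul_le_mul_right _ (by omega)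
      have := hg (Sum.inr c)
      rw [add_mul] at h2
      simp only; omega
  let f : F → Fin s := fun x => ⟨_, hlt x⟩
  have hinj : Function.Injective f := by
    rintro ⟨i, q⟩ ⟨j, q'⟩ h
    obtain ⟨h1, h2⟩ := s13_divmod (hg i) (hg j) (congrArg Fin.val h)
    obtain rfl := hginj _ _ h2
    exact congrArg _ (Fin.ext h1)
  have hcard : Fintype.card F = Fintype.card (Fin s) := by
    simp only [F, Fintype.card_sigma, Fintype.card_fin, Fintype.sum_sum_type, Sum.elim_inl,
      Sum.elim_inr, Finset.sum_const, Finset.card_univ, smul_eq_mul]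
    obtain ⟨d, rfl⟩ := Nat.exists_eq_add_of_lt hr
    have : r + d + 1 - r = d + 1 := by omega
    rw [this, hstr]; ring
  have hbij : Function.Bijective f := (Fintype.bijective_iff_injective_and_card f).2 ⟨hinj, hcard⟩
  refine ⟨(Equiv.ofBijective f hbij).symm, 1, isUnit_one, ?_⟩
  rw [inv_one, one_mul, mul_one, hpow]
  ext ⟨i, q⟩ ⟨j, q'⟩
  rw [Matrix.reindex_apply, Matrix.submatrix_apply, Matrix.blockDiagonal'_apply]
  simp only [Equiv.symm_symm, Equiv.ofBijective_apply, Matrix.of_apply, f]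
  by_cases hij : i = j
  · subst hij
    simp only [dif_pos, cast_eq, jordanBlock, Matrix.of_apply]
    have e1 : (q' : ℕ) * p + g i = q * p + g i ↔ (q' : ℕ) = q :=
      ⟨fun h => (s13_divmod (hg i) (hg i) h).1, fun h => by rw [h]⟩
    have e2 : (q' : ℕ) * p + g i = q * p + g i + p ↔ (q' : ℕ) = q + 1 :=
      ⟨fun h => (s13_divmod (a' := (q : ℕ) + 1) (hg i) (hg i) (by rw [h]; ring)).1,
        fun h => by rw [h]; ring⟩
    simp only [e1, e2]
  · rw [dif_neg hij, if_neg, if_neg]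
    · intro h
      exact hij (hginj _ _ (s13_divmod (a' := (q : ℕ) + 1) (hg j) (hg i)
        (by rw [h]; ring)).2.symm)
    · intro h
      exact hij (hginj _ _ (s13_divmod (hg j) (hg i) h).2.symm)
end
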